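/- arXiv:2208.09173 — 4 statements merged into one kernel-verified Lean document; each statement's English description precedes it below -/
import Mathlib

section
/- Let m, l, k₀, k₁ be non-negative integers and let G be the presented group ⟨x, y, γ ∣ (γ^(2^m) y^(2^l))^(2^k₀), (x y x⁻² y)^(2^k₁)⟩. Then the abelianization of G is an infinite cyclic group generated by the image of γ if and only if k₀ = k₁ = l = 0. -/
/-- A homomorphism to `ℤ` sending a generator to `1` exhibits its source as infinite cyclic. -/
theorem nonempty_mulEquiv_int_of_zpowers_eq_top {A : Type*} [Group A] {g : A}
    (hg : Subgroup.zpowers g = ⊤) (φ : A →* Multiplicative ℤ)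
    (hφ : φ g = Multiplicative.ofAdd 1) : Nonempty (A ≃* Multiplicative ℤ) := by
  have hpow (n : ℤ) : φ (g ^ n) = Multiplicative.ofAdd n := by
    rw [map_zpow, hφ, ← ofAdd_zsmul, smul_eq_mul, mul_one]
  refine ⟨MulEquiv.ofBijective φ ⟨(injective_iff_map_eq_one φ).2 fun a ha => ?_, fun z =>
    ⟨g ^ z.toAdd, hpow _⟩⟩⟩
  obtain ⟨n, rfl⟩ := Subgroup.mem_zpowers_iff.1 (hg ▸ Subgroup.mem_top a)
  rw [hpow, ofAdd_eq_one] at ha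
  rw [ha, zpow_zero]

/-- If the image of the generator `i` generates the abelianization of a presented group, then any
assignment of the generators in a commutative group which respects the relators and kills `i` is
trivial. -/
theorem PresentedGroup.eq_one_of_zpowers_abelianization_eq_top {α A : Type*} [CommGroup A]
    {rels : Set (FreeGroup α)} {i : α}
    (hi : Subgroup.zpowers (Abelianization.of (PresentedGroup.of i : PresentedGroup rels)) = ⊤)
    (f : α → A) (hf : ∀ r ∈ rels, FreeGroup.lift f r = 1) (hfi : f i = 1) (j : α) :
    f j = 1 := by
  obtain ⟨n, hn⟩ := Subgroup.mem_zpowers_iff.1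
    (hi ▸ Subgroup.mem_top (Abelianization.of (PresentedGroup.of j : PresentedGroup rels)))
  have h := congrArg (Abelianization.lift (PresentedGroup.toGroup hf)) hn
  rw [map_zpow, Abelianization.lift_apply_of, Abelianization.lift_apply_of,
    PresentedGroup.toGroup.of, PresentedGroup.toGroup.of, hfi, one_zpow] at h
  exact h.symm

/-- The abelianization of a presented group is generated by the image of the generator `i` as soon
as the images of all generators are powers of it. -/
theorem PresentedGroup.zpowers_abelianization_eq_top {α : Type*}
    {rels : Set (FreeGroup α)} {i : α}
    (h : ∀ j, Abelianization.of (PresentedGroup.of j : PresentedGroup rels) ∈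
      Subgroup.zpowers (Abelianization.of (PresentedGroup.of i : PresentedGroup rels))) :
    Subgroup.zpowers (Abelianization.of (PresentedGroup.of i : PresentedGroup rels)) = ⊤ := by
  refine eq_top_iff.2 fun a _ => ?_
  obtain ⟨b, rfl⟩ := QuotientGroup.mk_surjective a
  exact PresentedGroup.generated_by rels
    ((Subgroup.zpowers (Abelianization.of (PresentedGroup.of i))).comap Abelianization.of) h b

/-- Lemma 6.2(3), homological computation: the abelianization of
⟨x, y, γ ∣ (γ^(2^m) y^(2^l))^(2^k₀), (x y x⁻² y)^(2^k₁)⟩ is infinite cyclic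
generated by the image of γ iff k₀ = k₁ = l = 0.  (x = 0, y = 1, γ = 2.) -/
theorem stmt5 (m l k₀ k₁ : ℕ) :
    ∀ (rels : Set (FreeGroup (Fin 3))),
      rels = {((FreeGroup.of 2) ^ (2 ^ m) * (FreeGroup.of 1) ^ (2 ^ l)) ^ (2 ^ k₀),
               (FreeGroup.of 0 * FreeGroup.of 1 * (FreeGroup.of 0) ^ (-2 : ℤ) * FreeGroup.of 1) ^ (2 ^ k₁)} →
      ((Nonempty (Abelianization (PresentedGroup rels) ≃* Multiplicative ℤ) ∧
        Subgroup.zpowers (Abelianization.of (PresentedGroup.of ((2 : Fin 3)) : PresentedGroup rels)) = ⊤) ↔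
        (k₀ = 0 ∧ k₁ = 0 ∧ l = 0)) := by
  intro rels hrels
  constructor
  · rintro ⟨-, htop⟩
    let t : Multiplicative (ZMod 2) := Multiplicative.ofAdd 1
    have ht : t ≠ 1 := by decide
    have hsq : t ^ 2 = 1 := by decide
    have hpow {n : ℕ} (hn : n ≠ 0) : t ^ 2 ^ n = 1 := by
      obtain ⟨c, hc⟩ := dvd_pow_self 2 hn
      rw [hc, pow_mul, hsq, one_pow]
    have hy : ¬ (t ^ 2 ^ l) ^ 2 ^ k₀ = 1 := fun h =>
      ht <| PresentedGroup.eq_one_of_zpowers_abelianization_eq_top htop ![1, t, 1]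
        (by simp [hrels, h, ← sq, hsq]) rfl 1
    have hx : ¬ k₁ ≠ 0 := fun h =>
      ht <| PresentedGroup.eq_one_of_zpowers_abelianization_eq_top htop ![t, 1, 1]
        (by simp [hrels, hsq, hpow h]) rfl 0
    refine ⟨?_, not_not.1 hx, ?_⟩
    · by_contra h
      exact hy (by rw [pow_right_comm, hpow h, one_pow])
    · by_contra h
      exact hy (by rw [hpow h, one_pow])
  · rintro ⟨rfl, rfl, rfl⟩
    let q (j : Fin 3) : Abelianization (PresentedGroup rels) :=
      Abelianization.of (PresentedGroup.of j)
    let π : FreeGroup (Fin 3) →* Abelianization (PresentedGroup rels) :=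
      Abelianization.of.comp (PresentedGroup.mk rels)
    have hπ (j : Fin 3) : π (FreeGroup.of j) = q j := rfl
    have hone {r : FreeGroup (Fin 3)} (hr : r ∈ rels) : π r = 1 := by
      rw [MonoidHom.comp_apply, PresentedGroup.one_of_mem hr, map_one]
    have h₁ : q 2 ^ 2 ^ m * q 1 = 1 := by
      have h := hone (hrels.symm.subset (Set.mem_insert _ _))
      simpa only [map_mul, map_pow, hπ, pow_zero, pow_one] using h
    have h₂ : q 0 * q 1 * q 0 ^ (-2 : ℤ) * q 1 = 1 := by
      have h := hone (hrels.symm.subset (Set.mem_insert_of_mem _ rfl))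
      simpa only [map_mul, map_pow, map_zpow, hπ, pow_zero, pow_one] using h
    have hq₁ : q 1 ∈ Subgroup.zpowers (q 2) := by
      rw [eq_inv_of_mul_eq_one_right h₁]
      exact inv_mem (pow_mem (Subgroup.mem_zpowers _) _)
    have hq₀ : q 0 = q 1 ^ 2 := by
      have h : q 0 * q 1 * q 0 ^ (-2 : ℤ) * q 1 = (q 0)⁻¹ * q 1 ^ 2 := by
        rw [zpow_neg, zpow_ofNat, sq (q 0), sq (q 1), mul_inv, mul_right_comm (q 0),
          mul_inv_cancel_left, mul_assoc]
      exact inv_mul_eq_one.1 (h ▸ h₂)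
    have hq₀' : q 0 ∈ Subgroup.zpowers (q 2) := hq₀ ▸ pow_mem hq₁ 2
    have htop : Subgroup.zpowers (q 2) = ⊤ :=
      PresentedGroup.zpowers_abelianization_eq_top fun j => by
        fin_cases j
        · exact hq₀'
        · exact hq₁
        · exact Subgroup.mem_zpowers _
    let t : Multiplicative ℤ := Multiplicative.ofAdd 1
    let f : Fin 3 → Multiplicative ℤ := ![(t ^ 2 ^ m)⁻¹ ^ 2, (t ^ 2 ^ m)⁻¹, t]
    have hf : ∀ r ∈ rels, FreeGroup.lift f r = 1 := by
      have h (s : Multiplicative ℤ) : s ^ 2 * s * (s ^ 2) ^ (-2 : ℤ) * s = 1 := by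
        rw [← toAdd_eq_zero]
        simp only [toAdd_mul, toAdd_pow, toAdd_zpow, smul_eq_mul, nsmul_eq_mul]
        push_cast
        ring
      rw [hrels]
      rintro r (rfl | rfl)
      · simp [f]
      · simpa [f] using h (t ^ 2 ^ m)⁻¹
    exact ⟨nonempty_mulEquiv_int_of_zpowers_eq_top htop
      (Abelianization.lift (PresentedGroup.toGroup hf)) rfl, htop⟩
end

section
/- Let m, l, k₀, k₁, k₂ be non-negative integers and let G be the presented group ⟨x, y, γ ∣ (γ^(2^m) (x y x y⁻¹)^(2^l))^(2^k₀), x^(2^k₁), y^(2^k₂)⟩. Then the abelianization of G is a finite group; in particular, it is not an infinite cyclic group generated by the image of γ. -/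
/-- A commutative group generated by finitely many elements of finite order is finite. -/
theorem CommGroup.finite_of_closure_eq_top {A : Type*} [CommGroup A] {S : Set A}
    (hS : S.Finite) (hgen : Subgroup.closure S = ⊤) (hfin : ∀ a ∈ S, IsOfFinOrder a) :
    Finite A := by
  have : Group.FG A := ⟨⟨hS.toFinset, by rw [hS.coe_toFinset, hgen]⟩⟩
  refine CommGroup.finite_of_fg_isMulTorsion A fun a => ?_
  have hle : Subgroup.closure S ≤ CommGroup.torsion A := (Subgroup.closure_le _).2 hfin
  exact hle (hgen ▸ Subgroup.mem_top a)

/-- The images of the generators of a presentation generate the abelianization. -/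
theorem PresentedGroup.closure_range_abelianization_of {α : Type*} (rels : Set (FreeGroup α)) :
    Subgroup.closure (Set.range fun i =>
      Abelianization.of (PresentedGroup.of i : PresentedGroup rels)) = ⊤ := by
  have hsurj : Function.Surjective
      (Abelianization.of : PresentedGroup rels →* Abelianization (PresentedGroup rels)) :=
    QuotientGroup.mk_surjective
  rw [← Function.comp_def, Set.range_comp, ← MonoidHom.map_closure,
    PresentedGroup.closure_range_of, Subgroup.map_top_of_surjective _ hsurj]

/-- Lemma 6.3(5): the abelianization of
⟨x, y, γ ∣ (γ^(2^m) (x y x y⁻¹)^(2^l))^(2^k₀), x^(2^k₁), y^(2^k₂)⟩ is finite;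
in particular it is not infinite cyclic generated by the image of γ. -/
theorem stmt14 (m l k₀ k₁ k₂ : ℕ) :
    ∀ (rels : Set (FreeGroup (Fin 3))),
      rels = {((FreeGroup.of 2) ^ (2 ^ m) * (FreeGroup.of 0 * FreeGroup.of 1 * FreeGroup.of 0 * (FreeGroup.of 1)⁻¹) ^ (2 ^ l)) ^ (2 ^ k₀),
               (FreeGroup.of 0) ^ (2 ^ k₁),
               (FreeGroup.of 1) ^ (2 ^ k₂)} →
      (Finite (Abelianization (PresentedGroup rels)) ∧
        ¬(Nonempty (Abelianization (PresentedGroup rels) ≃* Multiplicative ℤ) ∧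
          Subgroup.zpowers (Abelianization.of (PresentedGroup.of ((2 : Fin 3)) : PresentedGroup rels)) = ⊤)) := by
  intro rels hrels
  let φ : FreeGroup (Fin 3) →* Abelianization (PresentedGroup rels) :=
    Abelianization.of.comp (PresentedGroup.mk rels)
  have hφ : ∀ r ∈ rels, φ r = 1 := fun r hr => by
    simp only [φ, MonoidHom.comp_apply, PresentedGroup.one_of_mem hr, map_one]
  have hx : IsOfFinOrder (φ (FreeGroup.of 0)) :=
    isOfFinOrder_iff_pow_eq_one.2 ⟨2 ^ k₁, by positivity, by
      rw [← map_pow]; exact hφ _ (by simp [hrels])⟩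
  have hy : IsOfFinOrder (φ (FreeGroup.of 1)) :=
    isOfFinOrder_iff_pow_eq_one.2 ⟨2 ^ k₂, by positivity, by
      rw [← map_pow]; exact hφ _ (by simp [hrels])⟩
  have hw : IsOfFinOrder (φ (FreeGroup.of 0 * FreeGroup.of 1 * FreeGroup.of 0 *
      (FreeGroup.of 1)⁻¹) ^ 2 ^ l) := by
    simp only [map_mul, map_inv]
    exact (((hx.mul hy).mul hx).mul hy.inv).pow
  have hγ : IsOfFinOrder (φ (FreeGroup.of 2)) := by
    have hprod : IsOfFinOrder (φ (FreeGroup.of 2) ^ 2 ^ m * φ (FreeGroup.of 0 * FreeGroup.of 1 *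
        FreeGroup.of 0 * (FreeGroup.of 1)⁻¹) ^ 2 ^ l) :=
      isOfFinOrder_iff_pow_eq_one.2 ⟨2 ^ k₀, by positivity, by
        rw [← map_pow, ← map_pow, ← map_mul, ← map_pow]; exact hφ _ (by simp [hrels])⟩
    refine IsOfFinOrder.of_pow (n := 2 ^ m) ?_ (by positivity)
    simpa using hprod.mul hw.inv
  have hfinite : Finite (Abelianization (PresentedGroup rels)) := by
    refine CommGroup.finite_of_closure_eq_top (Set.finite_range _)
      (PresentedGroup.closure_range_abelianization_of rels) ?_
    rintro _ ⟨i, rfl⟩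
    fin_cases i
    exacts [hx, hy, hγ]
  refine ⟨hfinite, fun ⟨⟨e⟩, _⟩ => ?_⟩
  have : Finite (Multiplicative ℤ) := Finite.of_equiv _ e.toEquiv
  exact not_finite (Multiplicative ℤ)
end

section
/- Let m, l, k₀, k₁, k₂ be non-negative integers and let G be the presented group ⟨x, y, γ ∣ (γ^(2^m) (x y)^(2^l))^(2^k₀), x^(2^k₁), (x y⁻²)^(2^k₂)⟩. Then the abelianization of G is a finite group; in particular, it is not an infinite cyclic group generated by the image of γ. -/
/-- A commutative group generated by finitely many elements of finite order is finite. -/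
theorem CommGroup.finite_of_surjective_freeGroup {ι A : Type*} [Finite ι] [CommGroup A]
    (φ : FreeGroup ι →* A) (hφ : Function.Surjective φ)
    (h : ∀ i, IsOfFinOrder (φ (FreeGroup.of i))) : Finite A := by
  have : Group.FG A := Group.fg_of_surjective hφ
  have hle : (⊤ : Subgroup (FreeGroup ι)) ≤ (CommGroup.torsion A).comap φ := by
    rw [← FreeGroup.closure_range_of, Subgroup.closure_le]
    rintro _ ⟨i, rfl⟩
    exact h i
  refine CommGroup.finite_of_fg_isMulTorsion A fun a => ?_
  obtain ⟨w, rfl⟩ := hφ a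
  exact hle (Subgroup.mem_top w)

/-- In a commutative group, a right factor of an element of finite order has finite order
if the left factor does. -/
theorem IsOfFinOrder.right_of_mul {A : Type*} [CommGroup A] {a b : A}
    (hab : IsOfFinOrder (a * b)) (ha : IsOfFinOrder a) : IsOfFinOrder b := by
  simpa using ha.inv.mul hab

/-- Lemma 6.3(7): the abelianization of
⟨x, y, γ ∣ (γ^(2^m) (x y)^(2^l))^(2^k₀), x^(2^k₁), (x y⁻²)^(2^k₂)⟩ is finite;
in particular it is not infinite cyclic generated by the image of γ. -/
theorem stmt16 (m l k₀ k₁ k₂ : ℕ) :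
    ∀ (rels : Set (FreeGroup (Fin 3))),
      rels = {((FreeGroup.of 2) ^ (2 ^ m) * (FreeGroup.of 0 * FreeGroup.of 1) ^ (2 ^ l)) ^ (2 ^ k₀),
               (FreeGroup.of 0) ^ (2 ^ k₁),
               (FreeGroup.of 0 * (FreeGroup.of 1) ^ (-2 : ℤ)) ^ (2 ^ k₂)} →
      (Finite (Abelianization (PresentedGroup rels)) ∧
        ¬(Nonempty (Abelianization (PresentedGroup rels) ≃* Multiplicative ℤ) ∧
          Subgroup.zpowers (Abelianization.of (PresentedGroup.of ((2 : Fin 3)) : PresentedGroup rels)) = ⊤)) := by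
  intro rels hrels
  have hfin : Finite (Abelianization (PresentedGroup rels)) := by
    let φ : FreeGroup (Fin 3) →* Abelianization (PresentedGroup rels) :=
      Abelianization.of.comp (PresentedGroup.mk rels)
    have hφ : Function.Surjective φ :=
      (QuotientGroup.mk'_surjective _).comp (PresentedGroup.mk_surjective rels)
    have hrel : ∀ (w : FreeGroup (Fin 3)) (k : ℕ), w ^ 2 ^ k ∈ rels → IsOfFinOrder (φ w) := by
      intro w k hw
      refine isOfFinOrder_iff_pow_eq_one.2 ⟨2 ^ k, by positivity, ?_⟩
      rw [← map_pow]
      exact (congrArg Abelianization.of (PresentedGroup.one_of_mem hw)).trans (map_one _)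
    have hx : IsOfFinOrder (φ (FreeGroup.of 0)) := hrel _ k₁ (by simp [hrels])
    have hy : IsOfFinOrder (φ (FreeGroup.of 1)) := by
      have h := hrel (FreeGroup.of 0 * FreeGroup.of 1 ^ (-2 : ℤ)) k₂ (by simp [hrels])
      rw [map_mul] at h
      have h' := (h.right_of_mul hx).inv
      rw [map_zpow, ← zpow_neg, neg_neg] at h'
      exact IsOfFinOrder.of_pow (n := 2) (mod_cast h') two_ne_zero
    have hγ : IsOfFinOrder (φ (FreeGroup.of 2)) := by
      have h := hrel (FreeGroup.of 2 ^ 2 ^ m * (FreeGroup.of 0 * FreeGroup.of 1) ^ 2 ^ l) k₀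
        (by simp [hrels])
      rw [map_mul, map_pow, map_pow, map_mul, mul_comm] at h
      exact (h.right_of_mul (hx.mul hy).pow).of_pow (by positivity)
    refine CommGroup.finite_of_surjective_freeGroup φ hφ fun i => ?_
    fin_cases i
    exacts [hx, hy, hγ]
  refine ⟨hfin, ?_⟩
  rintro ⟨⟨e⟩, -⟩
  have : Finite (Multiplicative ℤ) := Finite.of_equiv _ e.toEquiv
  exact not_finite (Multiplicative ℤ)
end

section
/- Let m, l, k₀, k₁, k₂ be non-negative integers and let G be the presented group ⟨x, y, γ ∣ (γ^(2^m) (x y⁻²)^(2^l))^(2^k₀), x^(2^k₁), (x y)^(2^k₂)⟩. Then the abelianization of G is a finite group; in particular, it is not an infinite cyclic group generated by the image of γ. -/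
/-- A presented group on finitely many generators has finite abelianization as soon as every
generator has finite order in the abelianization. -/
theorem PresentedGroup.finite_abelianization {α : Type*} [Finite α] {rels : Set (FreeGroup α)}
    (h : ∀ a : α, IsOfFinOrder (Abelianization.of (PresentedGroup.of a : PresentedGroup rels))) :
    Finite (Abelianization (PresentedGroup rels)) := by
  let φ : FreeGroup α →* Abelianization (PresentedGroup rels) :=
    Abelianization.of.comp (PresentedGroup.mk rels)
  have hφ : Function.Surjective φ :=
    (QuotientGroup.mk'_surjective _).comp (PresentedGroup.mk_surjective rels)
  have : Group.FG (Abelianization (PresentedGroup rels)) := Group.fg_of_surjective hφ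
  have hle : Subgroup.closure (Set.range FreeGroup.of) ≤
      (CommGroup.torsion (Abelianization (PresentedGroup rels))).comap φ := by
    rw [Subgroup.closure_le]
    rintro _ ⟨a, rfl⟩
    exact h a
  rw [FreeGroup.closure_range_of] at hle
  refine CommGroup.finite_of_fg_isMulTorsion _ fun g => ?_
  obtain ⟨w, rfl⟩ := hφ g
  exact hle (Subgroup.mem_top w)

/-- In a commutative group, the relations `(c ^ p * (a * b ^ n) ^ q) ^ r = 1`, `a ^ s = 1` and
`(a * b) ^ t = 1` with `p`, `r`, `s`, `t` positive force `a`, `b` and `c` to have finite order. -/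
theorem isOfFinOrder_of_relations {A : Type*} [CommGroup A] {a b c : A} {n : ℤ} {p q r s t : ℕ}
    (hp : 0 < p) (hr : 0 < r) (hs : 0 < s) (ht : 0 < t)
    (hc : (c ^ p * (a * b ^ n) ^ q) ^ r = 1) (ha : a ^ s = 1) (hab : (a * b) ^ t = 1) :
    IsOfFinOrder a ∧ IsOfFinOrder b ∧ IsOfFinOrder c := by
  have ha' : a ∈ CommGroup.torsion A := isOfFinOrder_iff_pow_eq_one.2 ⟨s, hs, ha⟩
  have hab' : a * b ∈ CommGroup.torsion A := isOfFinOrder_iff_pow_eq_one.2 ⟨t, ht, hab⟩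
  have hb' : b ∈ CommGroup.torsion A := (Subgroup.mul_mem_cancel_left _ ha').1 hab'
  have hc' : c ^ p * (a * b ^ n) ^ q ∈ CommGroup.torsion A :=
    isOfFinOrder_iff_pow_eq_one.2 ⟨r, hr, hc⟩
  have hq : (a * b ^ n) ^ q ∈ CommGroup.torsion A :=
    pow_mem (mul_mem ha' (zpow_mem hb' n)) q
  have hcp : IsOfFinOrder (c ^ p) := (Subgroup.mul_mem_cancel_right _ hq).1 hc'
  exact ⟨ha', hb', hcp.of_pow hp.ne'⟩

/-- Lemma 6.3(8): the abelianization of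
⟨x, y, γ ∣ (γ^(2^m) (x y⁻²)^(2^l))^(2^k₀), x^(2^k₁), (x y)^(2^k₂)⟩ is finite;
in particular it is not infinite cyclic generated by the image of γ. -/
theorem stmt17 (m l k₀ k₁ k₂ : ℕ) :
    ∀ (rels : Set (FreeGroup (Fin 3))),
      rels = {((FreeGroup.of 2) ^ (2 ^ m) * (FreeGroup.of 0 * (FreeGroup.of 1) ^ (-2 : ℤ)) ^ (2 ^ l)) ^ (2 ^ k₀),
               (FreeGroup.of 0) ^ (2 ^ k₁),
               (FreeGroup.of 0 * FreeGroup.of 1) ^ (2 ^ k₂)} →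
      (Finite (Abelianization (PresentedGroup rels)) ∧
        ¬(Nonempty (Abelianization (PresentedGroup rels) ≃* Multiplicative ℤ) ∧
          Subgroup.zpowers (Abelianization.of (PresentedGroup.of ((2 : Fin 3)) : PresentedGroup rels)) = ⊤)) := by
  intro rels hrels
  have hmem := hrels.ge
  simp only [Set.insert_subset_iff, Set.singleton_subset_iff] at hmem
  have hrel : ∀ w ∈ rels, Abelianization.of (PresentedGroup.mk rels w) = 1 := fun w hw => by
    rw [PresentedGroup.one_of_mem hw, map_one]
  have hc := hrel _ hmem.1
  have ha := hrel _ hmem.2.1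
  have hab := hrel _ hmem.2.2
  simp only [map_mul, map_pow, map_zpow] at hc ha hab
  obtain ⟨h₀, h₁, h₂⟩ := isOfFinOrder_of_relations (by positivity) (by positivity)
    (by positivity) (by positivity) hc ha hab
  have hfin : Finite (Abelianization (PresentedGroup rels)) :=
    PresentedGroup.finite_abelianization fun i => by
      fin_cases i
      exacts [h₀, h₁, h₂]
  refine ⟨hfin, fun ⟨⟨e⟩, _⟩ => ?_⟩
  have : Finite (Multiplicative ℤ) := Finite.of_equiv _ e.toEquiv
  exact not_finite (Multiplicative ℤ)
end
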